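/- (Visik's lemma) Let P : ℝ^n → ℝ^n be a continuous map and suppose there exists ρ > 0 such that the Euclidean inner product satisfies (P(ξ), ξ) ≥ 0 for all ξ ∈ ℝ^n with ‖ξ‖ = ρ. Then there exists ξ₀ ∈ ℝ^n with ‖ξ₀‖ ≤ ρ such that P(ξ₀) = 0. -/

import Mathlib

open scoped RealInnerProductSpace

open MeasureTheory Set Filter Topology Polynomial

section VisikAux

variable {E : Type*} [NormedAddCommGroup E] [InnerProductSpace ℝ E] [FiniteDimensional ℝ E]

theorem aux_det_poly (A : E →L[ℝ] E) :
    ∃ p : ℝ[X], p.natDegree ≤ Module.finrank ℝ E ∧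
      ∀ t : ℝ, p.eval t = (1 + t • A).det := by
  classical
  let b := Module.finBasis ℝ E
  let M := LinearMap.toMatrix b b (A : E →ₗ[ℝ] E)
  refine ⟨Matrix.det ((X : ℝ[X]) • M.map C + (1 : Matrix _ _ ℝ).map C), ?_, ?_⟩
  · simpa using natDegree_det_X_add_C_le M 1
  · intro t
    have h1 : (1 + t • A).det = LinearMap.det ((1 + t • A : E →L[ℝ] E) : E →ₗ[ℝ] E) := rfl
    rw [h1, ← LinearMap.det_toMatrix b, ← Polynomial.coe_evalRingHom, RingHom.map_det]
    congr 1
    have h2 : ((1 + t • A : E →L[ℝ] E) : E →ₗ[ℝ] E) = LinearMap.id + t • (A : E →ₗ[ℝ] E) := rfl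
    have h3 : LinearMap.toMatrix b b (LinearMap.id + t • (A : E →ₗ[ℝ] E)) = 1 + t • M := by
      rw [LinearEquiv.map_add, LinearEquiv.map_smul, LinearMap.toMatrix_id]
    rw [h2, h3]
    ext i j
    by_cases hij : i = j <;> simp [hij, add_comm] <;> exact mul_comm _ _

theorem aux_norm_poly (L : ℝ) (x v : E) :
    ∃ p : ℝ[X], p.natDegree ≤ 2 ∧ ∀ t : ℝ, p.eval t = L ^ 2 - ‖x + t • v‖ ^ 2 := by
  refine ⟨C (-‖v‖ ^ 2) * X ^ 2 + C (-2 * ⟪x, v⟫) * X + C (L ^ 2 - ‖x‖ ^ 2), ?_, ?_⟩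
  · compute_degree
  · intro t
    rw [norm_add_sq_real, norm_smul, inner_smul_right, mul_pow, Real.norm_eq_abs, sq_abs]
    simp
    ring

theorem aux_smooth (v : E → E) (hv : Continuous v) (R : ℝ) (hR0 : 0 < R)
    (hv0 : ∀ x, v x ≠ 0) (hvR : ∀ x, R ≤ ‖x‖ → v x = x) :
    ∃ g : E → E, ContDiff ℝ 1 g ∧ (∀ x, g x ≠ 0) ∧ ∀ x, R + 1 ≤ ‖x‖ → g x = x := by
  let T : E → Set E := fun x => {y | 0 < ⟪y, v x⟫ ∧ (R + 1 ≤ ‖x‖ → y = x)}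
  have hT : ∀ x, Convex ℝ (T x) := by
    intro x y hy z hz a b ha hb hab
    refine ⟨?_, fun hx => ?_⟩
    · rw [inner_add_left, real_inner_smul_left, real_inner_smul_left]
      rcases ha.eq_or_lt with rfl | ha'
      · have : b = 1 := by linarith
        subst this
        simpa using hz.1
      · have := mul_pos ha' hy.1
        have := mul_nonneg hb hz.1.le
        linarith
    · rw [hy.2 hx, hz.2 hx, ← add_smul, hab, one_smul]
  obtain ⟨g, hg⟩ := exists_contMDiffMap_forall_mem_convex_of_local (n := 1)
    (modelWithCornersSelf ℝ E) (t := T) hT (by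
      intro x
      rcases lt_or_ge ‖x‖ (R + 1) with hx | hx
      · refine ⟨{z | 0 < ⟪v x, v z⟫ ∧ ‖z‖ < R + 1}, ?_, fun _ => v x, contMDiffOn_const, ?_⟩
        · have h1 : ∀ᶠ z in 𝓝 x, 0 < ⟪v x, v z⟫ := by
            have hc : Continuous fun z => ⟪v x, v z⟫ := by fun_prop
            refine hc.continuousAt.eventually_const_lt ?_
            exact real_inner_self_pos.2 (hv0 x)
          have h2 : ∀ᶠ z in 𝓝 x, ‖z‖ < R + 1 := continuous_norm.continuousAt.eventually_lt_const hx
          exact h1.and h2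
        · rintro y ⟨hy1, hy2⟩
          exact ⟨hy1, fun h => absurd hy2 h.not_gt⟩
      · refine ⟨{z | R < ‖z‖}, ?_, id, contMDiffOn_id, ?_⟩
        · exact continuous_norm.continuousAt.eventually_const_lt (by linarith)
        · intro y hy
          refine ⟨?_, fun _ => rfl⟩
          have hy' : R < ‖y‖ := hy
          rw [hvR y hy'.le]
          refine real_inner_self_pos.2 (norm_pos_iff.1 (hR0.trans hy')))
  refine ⟨g, g.contMDiff.contDiff, fun x h0 => ?_, fun x hx => (hg x).2 hx⟩
  have := (hg x).1
  rw [h0, inner_zero_left] at this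
  exact lt_irrefl _ this

variable [MeasurableSpace E] [BorelSpace E]

theorem aux_interp (s : Set E) (F : ℝ → E → ℝ) (D : ℕ)
    (hp : ∀ x, ∃ p : ℝ[X], p.natDegree ≤ D ∧ ∀ t, p.eval t = F t x)
    (hF : ∀ t, IntegrableOn (F t) s) (t0 : ℝ) (ht0 : 0 < t0) (c : ℝ)
    (hc : ∀ t, 0 < t → t ≤ t0 → ∫ x in s, F t x = c) : ∫ x in s, F 1 x = c := by
  classical
  let v : ℕ → ℝ := fun i => t0 / (i + 1)
  let S := Finset.range (D + 1)
  have hv : Set.InjOn v S := by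
    intro i _ j _ hij
    simp only [v] at hij
    rw [div_eq_div_iff (by positivity) (by positivity)] at hij
    have := mul_left_cancel₀ ht0.ne' hij
    have h' : (j : ℝ) = i := by linarith
    exact_mod_cast h'.symm
  have key : ∀ x, F 1 x = ∑ i ∈ S, F (v i) x * (Lagrange.basis S v i).eval 1 := by
    intro x
    obtain ⟨p, hpD, hpe⟩ := hp x
    have hdeg : p.degree < S.card := by
      refine lt_of_le_of_lt degree_le_natDegree ?_
      simp only [S, Finset.card_range]
      exact_mod_cast Nat.lt_succ_of_le hpD
    have h1 := Lagrange.eq_interpolate hv hdeg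
    rw [← hpe 1, h1, Lagrange.interpolate_apply, eval_finsetSum]
    refine Finset.sum_congr rfl fun i _ => ?_
    rw [eval_mul, eval_C, hpe]
  simp_rw [key]
  rw [integral_finsetSum _ fun i _ => (hF (v i)).mul_const _]
  have : ∀ i ∈ S, ∫ x in s, F (v i) x * (Lagrange.basis S v i).eval 1
      = c * (Lagrange.basis S v i).eval 1 := by
    intro i _
    rw [integral_mul_const, hc (v i) (by positivity)]
    exact div_le_self ht0.le (by have : (0:ℝ) ≤ i := by positivity
                                 linarith)
  rw [Finset.sum_congr rfl this, ← Finset.mul_sum, ← eval_finsetSum,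
    Lagrange.sum_basis hv ⟨0, by simp [S]⟩]
  simp

theorem aux_small (φ : E → E) (hφ : ContDiff ℝ 1 φ) (R : ℝ)
    (hR : ∀ x, R ≤ ‖x‖ → φ x = 0) :
    ∃ t0 : ℝ, 0 < t0 ∧ ∀ t, 0 < t → t ≤ t0 → ∀ w : E → ℝ,
      ∫ x in Metric.closedBall 0 R, w (x + t • φ x) * (1 + t • fderiv ℝ φ x).det
        = ∫ x in Metric.closedBall 0 R, w x := by
  have hcs : HasCompactSupport φ := by
    refine HasCompactSupport.intro (isCompact_closedBall (0:E) R) fun x hx => hR x ?_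
    simp at hx
    exact hx.le
  obtain ⟨K, hK⟩ := hφ.lipschitzWith_of_hasCompactSupport hcs one_ne_zero
  refine ⟨1 / (2 * (K + 1)), by positivity, fun t ht ht1 w => ?_⟩
  have htK : t * K ≤ 1 / 2 := by
    have hK0 : (0:ℝ) ≤ K := K.2
    rw [le_div_iff₀ (by positivity)] at ht1
    nlinarith
  let f : E → E := fun x => x + t • φ x
  have hfl : ∀ x y, ‖(f x - f y) - (x - y)‖ ≤ 1 / 2 * ‖x - y‖ := by
    intro x y
    have : (f x - f y) - (x - y) = t • (φ x - φ y) := by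
      simp only [f, smul_sub]; abel
    rw [this, norm_smul, Real.norm_eq_abs, abs_of_pos ht]
    have h1 := hK.norm_sub_le x y
    calc t * ‖φ x - φ y‖ ≤ t * (K * ‖x - y‖) := by gcongr
      _ = (t * K) * ‖x - y‖ := by ring
      _ ≤ _ := by gcongr
  have hinj : Function.Injective f := by
    intro x y hxy
    have := hfl x y
    rw [hxy, sub_self, zero_sub, norm_neg] at this
    have h0 := norm_nonneg (x - y)
    have : ‖x - y‖ = 0 := by linarith
    exact sub_eq_zero.1 (norm_eq_zero.1 this)
  have hsurj : Function.Surjective f := by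
    have hA : ApproximatesLinearOn f ((ContinuousLinearEquiv.refl ℝ E : E ≃L[ℝ] E) : E →L[ℝ] E)
        univ (1 / 2) := by
      intro x _ y _
      simpa using hfl x y
    refine hA.surjective ?_
    rcases subsingleton_or_nontrivial E with hE | hE
    · exact Or.inl hE
    · right
      have h1 : ‖((ContinuousLinearEquiv.refl ℝ E).symm : E →L[ℝ] E)‖₊ = 1 := by
        ext
        exact ContinuousLinearMap.norm_id
      rw [h1, inv_one]
      exact NNReal.half_lt_self one_ne_zero
  have hid : ∀ x, R ≤ ‖x‖ → f x = x := fun x hx => by simp [f, hR x hx]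
  have himg : f '' Metric.closedBall 0 R = Metric.closedBall 0 R := by
    ext y
    simp only [mem_image, Metric.mem_closedBall, dist_zero_right]
    constructor
    · rintro ⟨x, hx, rfl⟩
      by_contra! hlt
      have := hinj (hid (f x) hlt.le)
      rw [this] at hlt
      linarith
    · intro hy
      obtain ⟨x, rfl⟩ := hsurj y
      refine ⟨x, ?_, rfl⟩
      by_contra! hlt
      rw [hid x hlt.le] at hy
      linarith
  have hdet : ∀ x, 0 < (1 + t • fderiv ℝ φ x).det := by
    intro x
    have hne : ∀ s ∈ Icc 0 t, (1 + s • fderiv ℝ φ x).det ≠ 0 := by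
      intro s hs h0
      have hker := LinearMap.bot_lt_ker_of_det_eq_zero
        (f := ((1 + s • fderiv ℝ φ x : E →L[ℝ] E) : E →ₗ[ℝ] E)) h0
      obtain ⟨u, hu, hu0⟩ := Submodule.exists_mem_ne_zero_of_ne_bot hker.ne'
      have hu1 : u + s • fderiv ℝ φ x u = 0 := hu
      have hK1 : ‖fderiv ℝ φ x‖ ≤ K := norm_fderiv_le_of_lipschitz ℝ hK
      have hK2 : ‖fderiv ℝ φ x u‖ ≤ K * ‖u‖ := (fderiv ℝ φ x).le_of_opNorm_le hK1 u
      have hu2 : ‖u‖ = s * ‖fderiv ℝ φ x u‖ := by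
        rw [eq_neg_of_add_eq_zero_left hu1, norm_neg, norm_smul, Real.norm_eq_abs,
          abs_of_nonneg hs.1, ← eq_neg_of_add_eq_zero_left hu1]
      have hu3 : 0 < ‖u‖ := norm_pos_iff.2 hu0
      have hu4 : s * ‖fderiv ℝ φ x u‖ ≤ t * (K * ‖u‖) :=
        mul_le_mul hs.2 hK2 (norm_nonneg _) ht.le
      have hu5 : (t * K) * ‖u‖ ≤ 1 / 2 * ‖u‖ := by gcongr
      linarith
    by_contra! hle
    have hcont : ContinuousOn (fun s : ℝ => (1 + s • fderiv ℝ φ x).det) (Icc 0 t) := by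
      apply Continuous.continuousOn
      exact ContinuousLinearMap.continuous_det.comp (by fun_prop)
    have := intermediate_value_Icc' ht.le hcont
    obtain ⟨s, hs, hs0⟩ := this ⟨hle, by simp [ContinuousLinearMap.det]⟩
    exact hne s hs hs0
  have hcv := integral_image_eq_integral_abs_det_fderiv_smul volume
    (s := Metric.closedBall (0:E) R) (f := f) (f' := fun x => 1 + t • fderiv ℝ φ x)
    Metric.isClosed_closedBall.measurableSet
    (fun x _ => by
      have h1 : HasFDerivAt φ (fderiv ℝ φ x) x :=
        (hφ.differentiable one_ne_zero x).hasFDerivAt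
      exact ((hasFDerivAt_id x).add (h1.const_smul t)).hasFDerivWithinAt) hinj.injOn w
  rw [himg] at hcv
  rw [hcv]
  refine integral_congr_ae (ae_of_all _ fun x => ?_)
  simp only [smul_eq_mul, abs_of_pos (hdet x), f]
  ring

theorem aux_nonvanish (g : E → E) (hg : ContDiff ℝ 1 g) (R : ℝ) (hR0 : 0 < R)
    (hR : ∀ x, R ≤ ‖x‖ → g x = x) : ∃ x, g x = 0 := by
  by_contra! hne
  let B := Metric.closedBall (0:E) R
  have hB : IsCompact B := isCompact_closedBall _ _
  have hBne : B.Nonempty := ⟨0, by simp [B, hR0.le]⟩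
  let φ : E → E := fun x => g x - x
  have hφ : ContDiff ℝ 1 φ := hg.sub contDiff_id
  obtain ⟨t0, ht0, hsm⟩ := aux_small φ hφ R (fun x hx => by simp [φ, hR x hx])
  have hdc : ∀ t : ℝ, Continuous fun x => (1 + t • fderiv ℝ φ x).det := fun t =>
    ContinuousLinearMap.continuous_det.comp
      (continuous_const.add ((hφ.continuous_fderiv one_ne_zero).const_smul t))
  obtain ⟨C, hC⟩ := hB.exists_bound_of_continuousOn (hdc 1).continuousOn
  obtain ⟨L0, hL0⟩ := hB.exists_bound_of_continuousOn hg.continuous.continuousOn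
  obtain ⟨x0, hx0, hmin⟩ := hB.exists_isMinOn hBne hg.continuous.norm.continuousOn
  set L := max L0 R with hL
  set ε := min ‖g x0‖ R with hε
  have hε0 : 0 < ε := lt_min (norm_pos_iff.2 (hne x0)) hR0
  have hεR : ε ≤ R := min_le_right _ _
  have hRL : R ≤ L := le_max_right _ _
  have hmain : ∀ N : ℕ, ∫ x in B, (L ^ 2 - ‖g x‖ ^ 2) ^ N * (1 + (1:ℝ) • fderiv ℝ φ x).det
      = ∫ x in B, (L ^ 2 - ‖x‖ ^ 2) ^ N := by
    intro N
    have := aux_interp B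
      (fun t x => (L ^ 2 - ‖x + t • φ x‖ ^ 2) ^ N * (1 + t • fderiv ℝ φ x).det)
      (2 * N + Module.finrank ℝ E) ?_ ?_ t0 ht0 (∫ x in B, (L ^ 2 - ‖x‖ ^ 2) ^ N)
      (fun t ht htt => hsm t ht htt fun x => (L ^ 2 - ‖x‖ ^ 2) ^ N)
    · simpa [φ] using this
    · intro x
      obtain ⟨p, hp, hpe⟩ := aux_norm_poly L x (φ x)
      obtain ⟨q, hq, hqe⟩ := aux_det_poly (fderiv ℝ φ x)
      refine ⟨p ^ N * q, ?_, fun t => by simp [hpe, hqe]⟩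
      refine natDegree_mul_le.trans (add_le_add (natDegree_pow_le.trans ?_) hq)
      rw [mul_comm]
      gcongr
    · intro t
      refine ContinuousOn.integrableOn_compact hB (Continuous.continuousOn ?_)
      have h1 := hφ.continuous
      have h2 := hdc t
      fun_prop
  have ha0 : 0 ≤ L ^ 2 - ε ^ 2 := by nlinarith
  have hb0 : 0 < L ^ 2 - (ε / 2) ^ 2 := by nlinarith
  have hup : ∀ N : ℕ, ∫ x in B, (L ^ 2 - ‖g x‖ ^ 2) ^ N * (1 + (1:ℝ) • fderiv ℝ φ x).det
      ≤ (L ^ 2 - ε ^ 2) ^ N * C * volume.real B := by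
    intro N
    refine (Real.le_norm_self _).trans ?_
    refine norm_setIntegral_le_of_norm_le_const hB.measure_lt_top fun x hx => ?_
    have h1 : ε ≤ ‖g x‖ := (min_le_left _ _).trans (hmin hx)
    have h2 : ‖g x‖ ≤ L := (hL0 x hx).trans (le_max_left _ _)
    rw [norm_mul]
    gcongr
    · rw [norm_pow, Real.norm_eq_abs, abs_of_nonneg (by nlinarith [norm_nonneg (g x)])]
      gcongr
      nlinarith [norm_nonneg (g x)]
    · exact hC x hx
  let B' := Metric.closedBall (0:E) (ε / 2)
  have hB'B : B' ⊆ B := Metric.closedBall_subset_closedBall (by linarith)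
  have hlow : ∀ N : ℕ, (L ^ 2 - (ε / 2) ^ 2) ^ N * volume.real B'
      ≤ ∫ x in B, (L ^ 2 - ‖x‖ ^ 2) ^ N := by
    intro N
    have hint : IntegrableOn (fun x : E => (L ^ 2 - ‖x‖ ^ 2) ^ N) B :=
      (by fun_prop : Continuous fun x : E => (L ^ 2 - ‖x‖ ^ 2) ^ N).continuousOn.integrableOn_compact hB
    calc (L ^ 2 - (ε / 2) ^ 2) ^ N * volume.real B'
        ≤ ∫ x in B', (L ^ 2 - ‖x‖ ^ 2) ^ N := by
          refine setIntegral_ge_of_const_le_real Metric.isClosed_closedBall.measurableSet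
            (isCompact_closedBall _ _).measure_lt_top.ne (fun x hx => ?_) (hint.mono_set hB'B)
          have : ‖x‖ ≤ ε / 2 := by simpa [B'] using hx
          gcongr
      _ ≤ _ := by
          refine setIntegral_mono_set hint ?_ hB'B.eventuallyLE
          refine (ae_restrict_iff' hB.measurableSet).2 (ae_of_all _ fun x hx => ?_)
          have : ‖x‖ ≤ R := by simpa [B] using hx
          have : 0 ≤ L ^ 2 - ‖x‖ ^ 2 := by nlinarith [norm_nonneg x]
          simp only [Pi.zero_apply]
          positivity
  have hv : 0 < volume.real B' :=
    ENNReal.toReal_pos (Metric.measure_closedBall_pos _ _ (by positivity)).ne'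
      (isCompact_closedBall _ _).measure_lt_top.ne
  have hfin : ∀ N : ℕ, volume.real B' ≤
      ((L ^ 2 - ε ^ 2) / (L ^ 2 - (ε / 2) ^ 2)) ^ N * (C * volume.real B) := by
    intro N
    have := (hlow N).trans ((hmain N).symm.le.trans (hup N))
    rw [div_pow, div_mul_eq_mul_div, le_div_iff₀ (by positivity)]
    linarith
  have hlim : Tendsto (fun N : ℕ => ((L ^ 2 - ε ^ 2) / (L ^ 2 - (ε / 2) ^ 2)) ^ N
      * (C * volume.real B)) atTop (𝓝 (0 * (C * volume.real B))) := by
    refine (tendsto_pow_atTop_nhds_zero_of_lt_one (by positivity) ?_).mul_const _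
    rw [div_lt_one hb0]
    nlinarith
  have := ge_of_tendsto' hlim hfin
  linarith

end VisikAux

/-- Visik's lemma: if `P : ℝⁿ → ℝⁿ` is continuous and `⟪P ξ, ξ⟫ ≥ 0` on the sphere
of radius `ρ > 0`, then `P` has a zero in the closed ball of radius `ρ`. -/
theorem visik_lemma (n : ℕ) (P : EuclideanSpace ℝ (Fin n) → EuclideanSpace ℝ (Fin n))
    (hP : Continuous P) (ρ : ℝ) (hρ : 0 < ρ)
    (h : ∀ ξ : EuclideanSpace ℝ (Fin n), ‖ξ‖ = ρ → 0 ≤ ⟪P ξ, ξ⟫) :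
    ∃ ξ₀ : EuclideanSpace ℝ (Fin n), ‖ξ₀‖ ≤ ρ ∧ P ξ₀ = 0 := by
  by_contra! hne
  let s : EuclideanSpace ℝ (Fin n) → ℝ := fun x => max 0 (min 1 (‖x‖ - ρ))
  let c : EuclideanSpace ℝ (Fin n) → ℝ := fun x => ρ / max ρ ‖x‖
  have hm : ∀ x : EuclideanSpace ℝ (Fin n), max ρ ‖x‖ ≠ 0 := fun x =>
    (lt_of_lt_of_le hρ (le_max_left _ _)).ne'
  have hs : Continuous s := by fun_prop
  have hc : Continuous c := by
    refine continuous_const.div (by fun_prop) hm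
  let v : EuclideanSpace ℝ (Fin n) → EuclideanSpace ℝ (Fin n) :=
    fun x => (1 - s x) • P (c x • x) + s x • x
  have hv : Continuous v := by fun_prop
  have hvR : ∀ x, ρ + 1 ≤ ‖x‖ → v x = x := by
    intro x hx
    have : s x = 1 := by
      simp only [s]
      rw [min_eq_left (by linarith), max_eq_right zero_le_one]
    simp [v, this]
  have hv0 : ∀ x, v x ≠ 0 := by
    intro x
    rcases le_or_gt ‖x‖ ρ with hx | hx
    · have h1 : s x = 0 := max_eq_left ((min_le_right _ _).trans (by linarith))
      have h2 : c x = 1 := by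
        simp only [c]
        rw [max_eq_left hx, div_self hρ.ne']
      simpa [v, h1, h2] using hne x hx
    · intro h0
      have hx0 : 0 < ‖x‖ := hρ.trans hx
      have hs0 : 0 < s x := lt_max_of_lt_right (lt_min one_pos (by linarith))
      have hs1 : s x ≤ 1 := max_le zero_le_one (min_le_left _ _)
      have hcx : c x = ρ / ‖x‖ := by
        simp only [c]
        rw [max_eq_right hx.le]
      have hc0 : 0 < c x := by rw [hcx]; positivity
      have hn : ‖c x • x‖ = ρ := by
        rw [norm_smul, Real.norm_eq_abs, abs_of_pos hc0, hcx]
        field_simp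
      have h1 := h _ hn
      rw [real_inner_smul_right] at h1
      have h2 : 0 ≤ ⟪P (c x • x), x⟫ := nonneg_of_mul_nonneg_right h1 hc0
      have h3 : ⟪v x, x⟫ = 0 := by rw [h0, inner_zero_left]
      simp only [v] at h3
      rw [inner_add_left, real_inner_smul_left, real_inner_smul_left,
        real_inner_self_eq_norm_sq] at h3
      have h4 : 0 < s x * ‖x‖ ^ 2 := by positivity
      have h5 := mul_nonneg (sub_nonneg.2 hs1) h2
      linarith
  obtain ⟨g, hg, hg0, hgR⟩ := aux_smooth v hv (ρ + 1) (by linarith) hv0 hvR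
  obtain ⟨x, hx⟩ := aux_nonvanish g hg (ρ + 1 + 1) (by linarith) hgR
  exact hg0 x hx
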